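/- For every x > 0, τ > 0 and every μ with 1 < μ < 9/8, the modified Bessel function admits the Laplace-type representation K_{2iτ}(2/√x) = (√(πx)/4)·∫_0^∞ e^{−√(xy)}·h(y,τ)·√y dy, where h(y,τ) = (1/(4·2π))·∫_ℝ Γ(s−1+iτ)·Γ(s−1−iτ)/(Γ(2−s)·Γ(3/2−s)) · (y/4)^{−s} dt with s = μ + it, and this Mellin–Barnes integral converges absolutely. -/

import Mathlib

open MeasureTheory Set Filter Asymptotics

/-- Modified Bessel function of the second kind (integral representation, for Re z > 0). -/
noncomputable def besselK (nu z : ℂ) : ℂ :=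
  ∫ t in Set.Ioi (0:ℝ), Complex.exp (-z * (Real.cosh t : ℂ)) * Complex.cosh (nu * (t : ℂ))

/-- The kernel 𝒦(x,τ) = ker²_{2iτ}(2(4x)^{1/4}) + kei²_{2iτ}(2(4x)^{1/4})
    = K_{2iτ}(2(4x)^{1/4}e^{iπ/4}) · K_{2iτ}(2(4x)^{1/4}e^{-iπ/4}), which is real. -/
noncomputable def kernelK (x τ : ℝ) : ℝ :=
  (besselK (2 * Complex.I * (τ:ℂ))
      (((2 * (4*x) ^ ((1:ℝ)/4) : ℝ) : ℂ) * Complex.exp (Complex.I * (Real.pi:ℂ) / 4)) *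
   besselK (2 * Complex.I * (τ:ℂ))
      (((2 * (4*x) ^ ((1:ℝ)/4) : ℝ) : ℂ) * Complex.exp (-(Complex.I * (Real.pi:ℂ)) / 4))).re

/-- K₀(y) = ∫₀^∞ exp(−y·cosh t) dt. -/
noncomputable def besselK0 (y : ℝ) : ℝ := ∫ t in Set.Ioi (0:ℝ), Real.exp (-y * Real.cosh t)

/-- K_{iτ}(x) = ∫₀^∞ exp(−x·cosh t)·cos(τt) dt (real-valued, purely imaginary order). -/
noncomputable def besselKi (τ x : ℝ) : ℝ :=
  ∫ t in Set.Ioi (0:ℝ), Real.exp (-x * Real.cosh t) * Real.cos (τ * t)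

/-- Modified Bessel function of the first kind I_ν(z) (power series). -/
noncomputable def besselI (nu z : ℂ) : ℂ :=
  ∑' n : ℕ, (z/2) ^ (nu + 2*(n:ℂ)) / ((n.factorial : ℂ) * Complex.Gamma (nu + (n:ℂ) + 1))

/-- B_ν(w) = ber²_ν(w) + bei²_ν(w) = I_ν(w·e^{iπ/4})·I_ν(w·e^{−iπ/4}). -/
noncomputable def kelvinB (nu w : ℂ) : ℂ :=
  besselI nu (w * Complex.exp (Complex.I * (Real.pi:ℂ) / 4)) *
  besselI nu (w * Complex.exp (-(Complex.I * (Real.pi:ℂ)) / 4))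

/-- Index transform (1.1): (F f)(τ) = ∫₀^∞ 𝒦(x,τ) f(x) dx. -/
noncomputable def indexF (f : ℝ → ℝ) (τ : ℝ) : ℝ := ∫ x in Set.Ioi (0:ℝ), kernelK x τ * f x

/-- Index transform (1.2): (G g)(x) = ∫₀^∞ 𝒦(x,τ) g(τ) dτ. -/
noncomputable def indexG (g : ℝ → ℝ) (x : ℝ) : ℝ := ∫ τ in Set.Ioi (0:ℝ), kernelK x τ * g τ

/-- Index transform (1.2) for complex-valued densities. -/
noncomputable def indexGC (g : ℝ → ℂ) (x : ℝ) : ℂ :=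
  ∫ τ in Set.Ioi (0:ℝ), (kernelK x τ : ℂ) * g τ

/-- Mellin transform of a real function. -/
noncomputable def mellinT (f : ℝ → ℝ) (s : ℂ) : ℂ :=
  ∫ x in Set.Ioi (0:ℝ), (f x : ℂ) * (x:ℂ) ^ (s - 1)

/-- Mellin transform of a complex function. -/
noncomputable def mellinC (F : ℝ → ℂ) (s : ℂ) : ℂ :=
  ∫ x in Set.Ioi (0:ℝ), F x * (x:ℂ) ^ (s - 1)

/-- The L_{ν,p}(ℝ₊) norm. -/
noncomputable def Lnorm (ν p : ℝ) (f : ℝ → ℝ) : ℝ :=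
  (∫ x in Set.Ioi (0:ℝ), |f x| ^ p * x ^ (ν*p - 1)) ^ (1/p)

/-- Euler beta function B(a,b) = Γ(a)Γ(b)/Γ(a+b). -/
noncomputable def betaFn (a b : ℝ) : ℝ := Real.Gamma a * Real.Gamma b / Real.Gamma (a+b)

/-- The function h(y,τ) of (2.17), a Mellin–Barnes line integral over Re s = μ. -/
noncomputable def hFn (μ y τ : ℝ) : ℂ :=
  (1/(8*(Real.pi:ℂ))) * ∫ t : ℝ,
    Complex.Gamma (((μ:ℂ) + (t:ℂ)*Complex.I) - 1 + Complex.I*(τ:ℂ))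
      * Complex.Gamma (((μ:ℂ) + (t:ℂ)*Complex.I) - 1 - Complex.I*(τ:ℂ))
      / (Complex.Gamma (2 - ((μ:ℂ) + (t:ℂ)*Complex.I)) * Complex.Gamma (3/2 - ((μ:ℂ) + (t:ℂ)*Complex.I)))
      * ((y:ℂ)/4) ^ (-((μ:ℂ) + (t:ℂ)*Complex.I))

theorem norm_Gamma_le_Gamma_re {z : ℂ} (hz : 0 < z.re) :
    ‖Complex.Gamma z‖ ≤ Real.Gamma z.re := by
  rw [Complex.Gamma_eq_integral hz, Real.Gamma_eq_integral hz, Complex.GammaIntegral]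
  refine (norm_integral_le_integral_norm _).trans (le_of_eq ?_)
  refine setIntegral_congr_fun measurableSet_Ioi fun x hx => ?_
  simp only [norm_mul, Complex.norm_real, Complex.norm_cpow_eq_rpow_re_of_pos hx,
    Complex.sub_re, Complex.one_re, Real.norm_eq_abs, abs_of_pos (Real.exp_pos _)]

theorem norm_Gamma_half_sq_mul_cosh (t : ℝ) :
    ‖Complex.Gamma (1 / 2 + t * Complex.I)‖ ^ 2 * Real.cosh (Real.pi * t) = Real.pi := by
  have h := Complex.Gamma_mul_Gamma_one_sub (1 / 2 + t * Complex.I)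
  have hc : (1 : ℂ) - (1 / 2 + t * Complex.I) = (starRingEnd ℂ) (1 / 2 + t * Complex.I) := by
    apply Complex.ext <;> simp
    norm_num
  have hs : Complex.sin (Real.pi * (1 / 2 + t * Complex.I))
      = (Real.cosh (Real.pi * t) : ℂ) := by
    rw [show (Real.pi : ℂ) * (1 / 2 + t * Complex.I)
      = (Real.pi * t) * Complex.I + Real.pi / 2 by ring, Complex.sin_add_pi_div_two,
      Complex.cos_mul_I]
    push_cast; rfl
  rw [hc, Complex.Gamma_conj, hs, Complex.mul_conj, Complex.normSq_eq_norm_sq,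
    eq_div_iff (by exact_mod_cast (Real.cosh_pos _).ne')] at h
  exact_mod_cast h

theorem norm_Gamma_half_le (t : ℝ) :
    ‖Complex.Gamma (1 / 2 + t * Complex.I)‖
      ≤ √(2 * Real.pi) * Real.exp (-(Real.pi / 2 * |t|)) := by
  have h := norm_Gamma_half_sq_mul_cosh t
  have hc : Real.exp (Real.pi * |t|) / 2 ≤ Real.cosh (Real.pi * t) := by
    rw [← Real.cosh_abs, abs_mul, abs_of_pos Real.pi_pos, Real.cosh_eq]
    have := Real.exp_pos (-(Real.pi * |t|))
    linarith
  refine abs_le_of_sq_le_sq' ?_ (by positivity) |>.2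
  rw [mul_pow, Real.sq_sqrt (by positivity), ← Real.exp_nat_mul]
  have he : Real.exp ((2 : ℕ) * -(Real.pi / 2 * |t|)) * Real.exp (Real.pi * |t|) = 1 := by
    rw [← Real.exp_add, ← Real.exp_zero]; congr 1; push_cast; ring
  have h2 := mul_le_mul_of_nonneg_left hc (sq_nonneg ‖Complex.Gamma (1 / 2 + t * Complex.I)‖)
  rw [h] at h2
  calc _ = (‖Complex.Gamma (1 / 2 + t * Complex.I)‖ ^ 2 * (Real.exp (Real.pi * |t|) / 2))
        * (2 * Real.exp ((2 : ℕ) * -(Real.pi / 2 * |t|))) := by linear_combination (-‖Complex.Gamma (1 / 2 + t * Complex.I)‖ ^ 2) * he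
    _ ≤ Real.pi * (2 * Real.exp ((2 : ℕ) * -(Real.pi / 2 * |t|))) := by gcongr
    _ = _ := by ring

theorem norm_Gamma_three_halves_le (t : ℝ) :
    ‖Complex.Gamma (3 / 2 + t * Complex.I)‖
      ≤ √(2 * Real.pi) * (1 + |t|) * Real.exp (-(Real.pi / 2 * |t|)) := by
  have hz : (1 / 2 + t * Complex.I : ℂ) ≠ 0 := fun h => by
    simpa using congrArg Complex.re h
  rw [show (3 / 2 + t * Complex.I : ℂ) = (1 / 2 + t * Complex.I) + 1 by ring,
    Complex.Gamma_add_one _ hz, norm_mul]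
  have h1 : ‖(1 / 2 + t * Complex.I : ℂ)‖ ≤ 1 + |t| := by
    refine (norm_add_le _ _).trans ?_
    simp
    norm_num
  calc _ ≤ (1 + |t|) * (√(2 * Real.pi) * Real.exp (-(Real.pi / 2 * |t|))) := by
        gcongr
        exact norm_Gamma_half_le t
    _ = _ := by ring

theorem norm_Gamma_le_of_mem_Icc {σ : ℝ} (hσ : σ ∈ Icc (1 / 2 : ℝ) (3 / 2)) (t : ℝ) :
    ‖Complex.Gamma (σ + t * Complex.I)‖
      ≤ √(2 * Real.pi) * 2 * (1 + |t|) ^ (σ - 1 / 2) * Real.exp (-(Real.pi / 2 * |t|)) := by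
  have hpi := Real.pi_gt_three
  obtain ⟨M, hM⟩ : ∃ M : ℝ, ∀ s ∈ Icc (1 / 2 : ℝ) (3 / 2), Real.Gamma s ≤ M := by
    obtain ⟨M, hM⟩ := (isCompact_Icc (a := (1 / 2 : ℝ)) (b := 3 / 2)).bddAbove_image
      (f := Real.Gamma) (fun s hs => (Real.differentiableAt_Gamma fun m => by
        have : (0 : ℝ) ≤ m := m.cast_nonneg
        have := hs.1
        intro h; linarith).continuousAt.continuousWithinAt)
    exact ⟨M, fun s hs => hM ⟨s, hs, rfl⟩⟩
  have hlarge : ∀ u : ℝ, |u + t| + |u - t| ≥ 2 * |t| ∧ |u + t| + |u - t| ≥ 2 * |u|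
      ∧ |u + t| ≤ |u| + |t| ∧ |u - t| ≤ |u| + |t| := by
    intro u
    refine ⟨?_, ?_, abs_add_le _ _, abs_sub _ _⟩
    · have := abs_sub (u + t) (u - t)
      rw [show u + t - (u - t) = 2 * t by ring, abs_mul, abs_two] at this
      linarith
    · have := abs_add_le (u + t) (u - t)
      rw [show u + t + (u - t) = 2 * u by ring, abs_mul, abs_two] at this
      linarith
  let f : ℂ → ℂ := fun z => Complex.Gamma (z + t * Complex.I) * Complex.Gamma (z - t * Complex.I)
  have hsplit : ∀ (z : ℂ) (s : ℝ), z.re = s →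
      f z = Complex.Gamma (s + (z.im + t : ℝ) * Complex.I)
        * Complex.Gamma (s + (z.im - t : ℝ) * Complex.I) := by
    rintro z s rfl
    simp only [f]
    congr 2 <;> apply Complex.ext <;> simp
  have key := Complex.HadamardThreeLines.norm_le_interp_of_mem_verticalClosedStrip'
    (f := f) (z := (σ : ℂ)) (l := 1 / 2) (u := 3 / 2)
    (a := 2 * Real.pi * Real.exp (-(Real.pi * |t|)))
    (b := 2 * Real.pi * (2 * (1 + |t|)) ^ 2 * Real.exp (-(Real.pi * |t|))) (by norm_num)
    (by simpa [Complex.HadamardThreeLines.verticalClosedStrip] using hσ) ?_ ?_ ?_ ?_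
  · have hfσ : ‖f σ‖ = ‖Complex.Gamma (σ + t * Complex.I)‖ ^ 2 := by
      simp only [f]
      rw [show (σ : ℂ) - t * Complex.I = (starRingEnd ℂ) (σ + t * Complex.I) by
        apply Complex.ext <;> simp, Complex.Gamma_conj, norm_mul, RCLike.norm_conj, sq]
    rw [hfσ, Complex.ofReal_re] at key
    have hθ : (σ - 1 / 2) / (3 / 2 - 1 / 2) = σ - 1 / 2 := by norm_num
    rw [hθ] at key
    refine abs_le_of_sq_le_sq' (key.trans ?_) (by positivity) |>.2
    set θ := σ - 1 / 2 with hθd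
    have hθ0 : 0 ≤ θ := by have := hσ.1; linarith
    have hθ1 : θ ≤ 1 := by have := hσ.2; linarith
    rw [show 2 * Real.pi * (2 * (1 + |t|)) ^ 2 * Real.exp (-(Real.pi * |t|))
      = (2 * Real.pi * Real.exp (-(Real.pi * |t|))) * (2 * (1 + |t|)) ^ 2 by ring,
      Real.mul_rpow (x := 2 * Real.pi * _) (by positivity) (by positivity), ← mul_assoc,
      ← Real.rpow_add (by positivity), sub_add_cancel, Real.rpow_one, ← Real.rpow_natCast,
      ← Real.rpow_mul (by positivity), mul_comm _ θ, Real.rpow_mul (by positivity),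
      Real.mul_rpow (by positivity) (by positivity), Real.rpow_natCast, mul_pow, mul_pow, mul_pow,
      mul_pow, Real.sq_sqrt (by positivity), ← Real.exp_nat_mul (-(Real.pi / 2 * |t|)),
      show ((2 : ℕ) : ℝ) * -(Real.pi / 2 * |t|) = -(Real.pi * |t|) by push_cast; ring]
    have h2 : ((2 : ℝ) ^ θ) ^ 2 ≤ 2 ^ 2 := by
      gcongr
      calc (2 : ℝ) ^ θ ≤ 2 ^ (1 : ℝ) := Real.rpow_le_rpow_of_exponent_le (by norm_num) hθ1
        _ = 2 := Real.rpow_one 2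
    calc _ = 2 * Real.pi * Real.exp (-(Real.pi * |t|)) * ((1 + |t|) ^ θ) ^ 2 * (2 ^ θ) ^ 2 := by ring
      _ ≤ 2 * Real.pi * Real.exp (-(Real.pi * |t|)) * ((1 + |t|) ^ θ) ^ 2 * 2 ^ 2 := by gcongr
      _ = _ := by ring
  · apply DifferentiableOn.diffContOnCl
    intro z hz
    have hz' : z.re ∈ Icc (1 / 2 : ℝ) (3 / 2) := by
      have : closure (Complex.HadamardThreeLines.verticalStrip (1 / 2) (3 / 2))
          ⊆ Complex.re ⁻¹' Icc (1 / 2 : ℝ) (3 / 2) :=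
        closure_minimal (preimage_mono Ioo_subset_Icc_self)
          (isClosed_Icc.preimage Complex.continuous_re)
      exact this hz
    have hd : ∀ w : ℂ, w.re = z.re → DifferentiableAt ℂ Complex.Gamma w := fun w hw =>
      Complex.differentiableAt_Gamma _ fun m h => by
        have h := congrArg Complex.re h
        have h0 : (0 : ℝ) ≤ m := m.cast_nonneg
        simp only [Complex.neg_re, Complex.natCast_re] at h
        have := hz'.1
        linarith
    refine DifferentiableAt.differentiableWithinAt (DifferentiableAt.mul ?_ ?_)
    · exact DifferentiableAt.comp z (hd _ (by simp)) (by fun_prop)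
    · exact DifferentiableAt.comp z (hd _ (by simp)) (by fun_prop)
  · refine ⟨M * M, ?_⟩
    rintro _ ⟨z, hz, rfl⟩
    have hz' : z.re ∈ Icc (1 / 2 : ℝ) (3 / 2) := hz
    have hb : ∀ w : ℂ, w.re = z.re → ‖Complex.Gamma w‖ ≤ M := fun w hw =>
      (norm_Gamma_le_Gamma_re (by have := hz'.1; linarith)).trans (hM _ (hw ▸ hz'))
    have hb1 := hb (z + t * Complex.I) (by simp)
    simp only [Function.comp, f, norm_mul]
    exact mul_le_mul hb1 (hb _ (by simp)) (norm_nonneg _) ((norm_nonneg _).trans hb1)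
  · intro z hz
    obtain ⟨h1, -, -, -⟩ := hlarge z.im
    rw [hsplit z (1 / 2) hz, norm_mul]
    push_cast [-Complex.ofReal_add, -Complex.ofReal_sub]
    calc _ ≤ (√(2 * Real.pi) * Real.exp (-(Real.pi / 2 * |z.im + t|)))
          * (√(2 * Real.pi) * Real.exp (-(Real.pi / 2 * |z.im - t|))) :=
          mul_le_mul (norm_Gamma_half_le _) (norm_Gamma_half_le _) (norm_nonneg _) (by positivity)
      _ = 2 * Real.pi * Real.exp (-(Real.pi / 2 * (|z.im + t| + |z.im - t|))) := by
          rw [mul_mul_mul_comm, Real.mul_self_sqrt (by positivity), ← Real.exp_add]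
          ring_nf
      _ ≤ _ := by
          refine mul_le_mul_of_nonneg_left (Real.exp_le_exp.2 ?_) (by positivity)
          nlinarith
  · intro z hz
    obtain ⟨h1, h2, h3, h4⟩ := hlarge z.im
    rw [hsplit z (3 / 2) hz, norm_mul]
    push_cast [-Complex.ofReal_add, -Complex.ofReal_sub]
    set m := max |z.im| |t|
    have hm1 : |z.im| ≤ m := le_max_left _ _
    have hm2 : |t| ≤ m := le_max_right _ _
    have hm : 2 * m ≤ |z.im + t| + |z.im - t| := by
      rcases max_choice |z.im| |t| with h | h <;> simp only [m, h] <;> assumption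
    have ht0 := abs_nonneg t
    have hgrow : 1 + m ≤ (1 + |t|) * Real.exp (m - |t|) := by
      have := Real.add_one_le_exp (m - |t|)
      nlinarith
    calc _ ≤ (√(2 * Real.pi) * (1 + |z.im + t|) * Real.exp (-(Real.pi / 2 * |z.im + t|)))
          * (√(2 * Real.pi) * (1 + |z.im - t|) * Real.exp (-(Real.pi / 2 * |z.im - t|))) :=
          mul_le_mul (norm_Gamma_three_halves_le _) (norm_Gamma_three_halves_le _)
            (norm_nonneg _) (by positivity)
      _ = 2 * Real.pi * ((1 + |z.im + t|) * (1 + |z.im - t|))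
            * Real.exp (-(Real.pi / 2 * (|z.im + t| + |z.im - t|))) := by
          rw [mul_add (Real.pi / 2), neg_add, Real.exp_add]
          linear_combination ((1 + |z.im + t|) * (1 + |z.im - t|)
            * (Real.exp (-(Real.pi / 2 * |z.im + t|)) * Real.exp (-(Real.pi / 2 * |z.im - t|))))
            * Real.mul_self_sqrt (show 0 ≤ 2 * Real.pi by positivity)
      _ ≤ 2 * Real.pi * ((2 * (1 + m)) * (2 * (1 + m))) * Real.exp (-(Real.pi * m)) := by
          refine mul_le_mul (mul_le_mul_of_nonneg_left (mul_le_mul ?_ ?_ (by positivity) ?_)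
            (by positivity)) (Real.exp_le_exp.2 ?_) (by positivity) (by positivity)
          · linarith
          · linarith
          · linarith
          · nlinarith
      _ ≤ 2 * Real.pi * ((2 * ((1 + |t|) * Real.exp (m - |t|)))
            * (2 * ((1 + |t|) * Real.exp (m - |t|)))) * Real.exp (-(Real.pi * m)) := by
          have : 0 ≤ m := ht0.trans hm2
          gcongr
      _ = 2 * Real.pi * (2 * (1 + |t|)) ^ 2
            * Real.exp ((m - |t|) + (m - |t|) + -(Real.pi * m)) := by
          rw [Real.exp_add, Real.exp_add]; ring
      _ ≤ _ := by
          gcongr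
          nlinarith

theorem exists_norm_Gamma_le {σ : ℝ} (hσ0 : 0 < σ) (hσ1 : σ ≤ 3 / 2) :
    ∃ C : ℝ, 0 < C ∧ ∀ t : ℝ, ‖Complex.Gamma (σ + t * Complex.I)‖
      ≤ C * (1 + |t|) ^ (σ - 1 / 2) * Real.exp (-(Real.pi / 2 * |t|)) := by
  rcases le_or_gt (1 / 2) σ with h | h
  · exact ⟨√(2 * Real.pi) * 2, by positivity, fun t => norm_Gamma_le_of_mem_Icc ⟨h, hσ1⟩ t⟩
  refine ⟨√(2 * Real.pi) * 2 * (2 / σ), by positivity, fun t => ?_⟩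
  set z : ℂ := σ + t * Complex.I with hz
  have hre : z.re = σ := by simp [hz]
  have him : z.im = t := by simp [hz]
  have hz0 : z ≠ 0 := fun h0 => by rw [h0] at hre; simp at hre; linarith
  have hlow : σ / 2 * (1 + |t|) ≤ ‖z‖ := by
    have h1 := Complex.abs_re_le_norm z
    have h2 := Complex.abs_im_le_norm z
    rw [hre, abs_of_pos hσ0] at h1
    rw [him] at h2
    nlinarith [abs_nonneg t]
  have hb := norm_Gamma_le_of_mem_Icc (σ := σ + 1) ⟨by linarith, by linarith⟩ t
  rw [show ((σ + 1 : ℝ) : ℂ) + t * Complex.I = z + 1 by rw [hz]; push_cast; ring,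
    Complex.Gamma_add_one _ hz0, norm_mul, show σ + 1 - 1 / 2 = (σ - 1 / 2) + 1 by ring,
    Real.rpow_add_one (by positivity)] at hb
  have hpos : 0 < σ / 2 * (1 + |t|) := by positivity
  refine le_of_mul_le_mul_left ?_ hpos
  calc _ ≤ ‖z‖ * ‖Complex.Gamma z‖ := by gcongr
    _ ≤ _ := hb
    _ = _ := by field_simp

theorem exists_norm_inv_Gamma_one_sub_le {σ : ℝ} (hσ0 : 0 < σ) (hσ1 : σ < 1) :
    ∃ C : ℝ, 0 < C ∧ ∀ t : ℝ, ‖(Complex.Gamma (1 - (σ + t * Complex.I)))⁻¹‖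
      ≤ C * (1 + |t|) ^ (σ - 1 / 2) * Real.exp (Real.pi / 2 * |t|) := by
  obtain ⟨C, hC, hb⟩ := exists_norm_Gamma_le hσ0 (by linarith : σ ≤ 3 / 2)
  refine ⟨C / Real.pi, by positivity, fun t => ?_⟩
  set z : ℂ := σ + t * Complex.I with hz
  have hpi : (Real.pi : ℂ) ≠ 0 := by exact_mod_cast Real.pi_ne_zero
  have hz0 : Complex.Gamma z ≠ 0 := Complex.Gamma_ne_zero_of_re_pos (by simpa [hz])
  have hz1 : Complex.Gamma (1 - z) ≠ 0 := Complex.Gamma_ne_zero_of_re_pos (by simpa [hz])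
  have h := Complex.Gamma_mul_Gamma_one_sub z
  have hsin : Complex.sin (Real.pi * z) ≠ 0 := fun h0 => by
    rw [h0, div_zero] at h
    exact mul_ne_zero hz0 hz1 h
  have heq : (Complex.Gamma (1 - z))⁻¹ = Complex.Gamma z * Complex.sin (Real.pi * z) / Real.pi := by
    rw [eq_div_iff hsin] at h
    rw [eq_div_iff hpi, inv_mul_eq_iff_eq_mul₀ hz1]
    linear_combination -h
  have hs : ‖Complex.sin (Real.pi * z)‖ ≤ Real.exp (Real.pi * |t|) := by
    have him : (Real.pi * z).im = Real.pi * t := by simp [hz]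
    have h1 : ‖Complex.exp (-(Real.pi * z) * Complex.I)‖ ≤ Real.exp (Real.pi * |t|) := by
      rw [Complex.norm_exp]
      gcongr
      have : (-(Real.pi * z) * Complex.I).re = Real.pi * t := by simp [hz]
      rw [this]
      exact mul_le_mul_of_nonneg_left (le_abs_self t) Real.pi_pos.le
    have h2 : ‖Complex.exp ((Real.pi * z) * Complex.I)‖ ≤ Real.exp (Real.pi * |t|) := by
      rw [Complex.norm_exp]
      gcongr
      have : ((Real.pi * z) * Complex.I).re = Real.pi * (-t) := by simp [hz]
      rw [this]
      exact mul_le_mul_of_nonneg_left (neg_le_abs t) Real.pi_pos.le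
    rw [Complex.sin, norm_div, norm_mul, Complex.norm_I, mul_one, Complex.norm_two]
    have := norm_sub_le (Complex.exp (-(Real.pi * z) * Complex.I))
      (Complex.exp ((Real.pi * z) * Complex.I))
    linarith
  rw [heq, norm_div, norm_mul, Complex.norm_real, Real.norm_of_nonneg Real.pi_pos.le]
  calc _ ≤ (C * (1 + |t|) ^ (σ - 1 / 2) * Real.exp (-(Real.pi / 2 * |t|)))
        * Real.exp (Real.pi * |t|) / Real.pi := by
        gcongr
        exact hb t
    _ = C / Real.pi * (1 + |t|) ^ (σ - 1 / 2)
        * (Real.exp (-(Real.pi / 2 * |t|)) * Real.exp (Real.pi * |t|)) := by ring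
    _ = _ := by
        rw [← Real.exp_add]
        ring_nf

theorem one_add_abs_add_rpow_le {p : ℝ} (hp : p ≤ 0) (t c : ℝ) :
    (1 + |t + c|) ^ p ≤ (1 + |c|) ^ (-p) * (1 + |t|) ^ p := by
  have h : (1 + |t|) / (1 + |c|) ≤ 1 + |t + c| := by
    rw [div_le_iff₀ (by positivity)]
    have := abs_sub (t + c) c
    rw [add_sub_cancel_right] at this
    nlinarith [abs_nonneg (t + c), abs_nonneg c]
  refine (Real.rpow_le_rpow_of_nonpos (by positivity) h hp).trans (le_of_eq ?_)
  rw [Real.div_rpow (by positivity) (by positivity), Real.rpow_neg (by positivity)]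
  field_simp

theorem continuous_Gamma_vertical {f : ℝ → ℂ} (hf : Continuous f) (hre : ∀ t, 0 < (f t).re) :
    Continuous fun t => Complex.Gamma (f t) :=
  continuous_iff_continuousAt.2 fun t => ContinuousAt.comp (f := f)
    (Complex.differentiableAt_Gamma _ fun m h => by
      have h := congrArg Complex.re h
      have h0 : (0 : ℝ) ≤ m := m.cast_nonneg
      simp only [Complex.neg_re, Complex.natCast_re] at h
      have := hre t
      linarith).continuousAt hf.continuousAt

theorem integrable_Gamma_vertical {σ : ℝ} (hσ0 : 0 < σ) (hσ1 : σ ≤ 1 / 2) :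
    Integrable fun t : ℝ => Complex.Gamma (σ + t * Complex.I) := by
  obtain ⟨C, hC, hb⟩ := exists_norm_Gamma_le hσ0 (by linarith : σ ≤ 3 / 2)
  have hint : Integrable fun t : ℝ => C * 4 * (1 + ‖t‖) ^ (-2 : ℝ) :=
    (integrable_one_add_norm (by norm_num)).const_mul _
  refine hint.mono' (continuous_Gamma_vertical (by fun_prop)
    (by simpa using hσ0)).aestronglyMeasurable (ae_of_all _ fun t => (hb t).trans ?_)
  rw [Real.norm_eq_abs, Real.rpow_neg (by positivity), Real.rpow_ofNat]
  have h1 : (1 + |t|) ^ (σ - 1 / 2) ≤ 1 :=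
    Real.rpow_le_one_of_one_le_of_nonpos (by linarith [abs_nonneg t]) (by linarith)
  have h2 : (1 + |t|) / 2 ≤ Real.exp (Real.pi / 4 * |t|) := by
    have := Real.add_one_le_exp (Real.pi / 4 * |t|)
    nlinarith [Real.pi_gt_three, abs_nonneg t]
  have h3 : Real.exp (-(Real.pi / 2 * |t|)) ≤ 4 * ((1 + |t|) ^ 2)⁻¹ := by
    have : -(Real.pi / 2 * |t|) = -(Real.pi / 4 * |t| + Real.pi / 4 * |t|) := by ring
    rw [this, Real.exp_neg, Real.exp_add, inv_le_comm₀ (by positivity) (by positivity), mul_inv,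
      inv_inv]
    have h0 : 0 ≤ (1 + |t|) / 2 := by positivity
    nlinarith
  calc _ ≤ C * 1 * (4 * ((1 + |t|) ^ 2)⁻¹) := by gcongr
    _ = _ := by ring

/-- The quotient of Gamma functions in the Mellin–Barnes integrand, on the line `Re s = μ`. -/
noncomputable def gammaQuotient (μ τ t : ℝ) : ℂ :=
  Complex.Gamma (((μ:ℂ) + (t:ℂ)*Complex.I) - 1 + Complex.I*(τ:ℂ))
    * Complex.Gamma (((μ:ℂ) + (t:ℂ)*Complex.I) - 1 - Complex.I*(τ:ℂ))
    / (Complex.Gamma (2 - ((μ:ℂ) + (t:ℂ)*Complex.I)) *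
      Complex.Gamma (3/2 - ((μ:ℂ) + (t:ℂ)*Complex.I)))

theorem integrable_gammaQuotient {μ : ℝ} (hμ1 : 1 < μ) (hμ2 : μ < 9 / 8) (τ : ℝ) :
    Integrable (gammaQuotient μ τ) := by
  obtain ⟨a, rfl⟩ : ∃ a, μ = a + 1 := ⟨μ - 1, by ring⟩
  have ha0 : 0 < a := by linarith
  have ha1 : a < 1 / 8 := by linarith
  obtain ⟨C₁, hC₁, hb₁⟩ := exists_norm_Gamma_le ha0 (by linarith)
  obtain ⟨C₂, hC₂, hb₂⟩ := exists_norm_inv_Gamma_one_sub_le ha0 (by linarith)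
  obtain ⟨C₃, hC₃, hb₃⟩ := exists_norm_inv_Gamma_one_sub_le (σ := a + 1 / 2)
    (by linarith) (by linarith)
  have hp : a - 1 / 2 ≤ 0 := by linarith
  set D := (1 + |τ|) ^ (-(a - 1 / 2)) with hD
  have hD0 : 0 < D := by positivity
  have hint : Integrable fun t : ℝ => C₁ * D * (C₁ * D) * (C₂ * C₃)
      * (1 + ‖t‖) ^ (-(3 / 2 - 4 * a)) :=
    (integrable_one_add_norm (by norm_num; linarith)).const_mul _
  refine hint.mono' ?_ (ae_of_all _ fun t => ?_)
  · refine Continuous.aestronglyMeasurable (Continuous.div (Continuous.mul ?_ ?_)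
      (Continuous.mul ?_ ?_) fun t => mul_ne_zero (Complex.Gamma_ne_zero_of_re_pos ?_)
      (Complex.Gamma_ne_zero_of_re_pos ?_))
    · exact continuous_Gamma_vertical (by fun_prop) (by simpa)
    · exact continuous_Gamma_vertical (by fun_prop) (by simpa)
    · exact continuous_Gamma_vertical (by fun_prop) fun t => by simp; linarith
    · exact continuous_Gamma_vertical (by fun_prop) fun t => by simp; linarith
    · simp; linarith
    · simp; linarith
  · have e1 : (((a + 1 : ℝ):ℂ) + (t:ℂ)*Complex.I) - 1 + Complex.I*(τ:ℂ)
        = a + (t + τ : ℝ) * Complex.I := by push_cast; ring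
    have e2 : (((a + 1 : ℝ):ℂ) + (t:ℂ)*Complex.I) - 1 - Complex.I*(τ:ℂ)
        = a + (t + -τ : ℝ) * Complex.I := by push_cast; ring
    have e3 : 2 - (((a + 1 : ℝ):ℂ) + (t:ℂ)*Complex.I) = 1 - (a + t * Complex.I) := by
      push_cast; ring
    have e4 : 3 / 2 - (((a + 1 : ℝ):ℂ) + (t:ℂ)*Complex.I)
        = 1 - ((a + 1 / 2 : ℝ) + t * Complex.I) := by push_cast; ring
    rw [gammaQuotient, e1, e2, e3, e4, div_eq_mul_inv, mul_inv, norm_mul, norm_mul, norm_mul,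
      Real.norm_eq_abs]
    have q1 := one_add_abs_add_rpow_le hp t τ
    have q2 := one_add_abs_add_rpow_le hp t (-τ)
    rw [abs_neg] at q2
    rw [← hD] at q1 q2
    have hexp : Real.exp (-(Real.pi / 2 * |t + τ|)) * Real.exp (-(Real.pi / 2 * |t + -τ|))
        * (Real.exp (Real.pi / 2 * |t|) * Real.exp (Real.pi / 2 * |t|)) ≤ 1 := by
      rw [← Real.exp_add, ← Real.exp_add, ← Real.exp_add, Real.exp_le_one_iff]
      have h := abs_add_le (t + τ) (t + -τ)
      rw [show t + τ + (t + -τ) = 2 * t by ring, abs_mul, abs_two] at h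
      nlinarith [Real.pi_pos]
    have hpow : (1 + |t|) ^ (-(3 / 2 - 4 * a)) = (1 + |t|) ^ (a - 1 / 2) * (1 + |t|) ^ (a - 1 / 2)
        * ((1 + |t|) ^ (a - 1 / 2) * (1 + |t|) ^ (a + 1 / 2 - 1 / 2)) := by
      rw [← Real.rpow_add (by positivity), ← Real.rpow_add (by positivity),
        ← Real.rpow_add (by positivity)]
      ring_nf
    calc _ ≤ (C₁ * (D * (1 + |t|) ^ (a - 1 / 2)) * Real.exp (-(Real.pi / 2 * |t + τ|)))
          * (C₁ * (D * (1 + |t|) ^ (a - 1 / 2)) * Real.exp (-(Real.pi / 2 * |t + -τ|)))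
          * ((C₂ * (1 + |t|) ^ (a - 1 / 2) * Real.exp (Real.pi / 2 * |t|))
          * (C₃ * (1 + |t|) ^ (a + 1 / 2 - 1 / 2) * Real.exp (Real.pi / 2 * |t|))) := by
          have r1 := (hb₁ (t + τ)).trans (mul_le_mul_of_nonneg_right
            (mul_le_mul_of_nonneg_left q1 hC₁.le) (Real.exp_pos _).le)
          have r2 := (hb₁ (t + -τ)).trans (mul_le_mul_of_nonneg_right
            (mul_le_mul_of_nonneg_left q2 hC₁.le) (Real.exp_pos _).le)
          have r3 := hb₂ t
          have r4 := hb₃ t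
          gcongr
      _ = C₁ * D * (C₁ * D) * (C₂ * C₃) * (1 + |t|) ^ (-(3 / 2 - 4 * a))
          * (Real.exp (-(Real.pi / 2 * |t + τ|)) * Real.exp (-(Real.pi / 2 * |t + -τ|))
            * (Real.exp (Real.pi / 2 * |t|) * Real.exp (Real.pi / 2 * |t|))) := by
          rw [hpow]; ring
      _ ≤ _ := mul_le_of_le_one_right (by positivity) hexp

theorem mellinConvergent_exp_neg {s : ℂ} (hs : 0 < s.re) :
    MellinConvergent (fun x : ℝ => ((Real.exp (-x) : ℝ) : ℂ)) s := by
  have := Complex.GammaIntegral_convergent hs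
  simpa only [MellinConvergent, smul_eq_mul, mul_comm] using this

theorem mellin_exp_neg {s : ℂ} (hs : 0 < s.re) :
    mellin (fun x : ℝ => ((Real.exp (-x) : ℝ) : ℂ)) s = Complex.Gamma s := by
  rw [Complex.Gamma_eq_integral hs, Complex.GammaIntegral_eq_mellin]

theorem integral_Gamma_mul_cpow_neg {σ u : ℝ} (hσ0 : 0 < σ) (hσ1 : σ ≤ 1 / 2) (hu : 0 < u) :
    ∫ t : ℝ, Complex.Gamma (σ + t * Complex.I) * (u : ℂ) ^ (-(σ + t * Complex.I))
      = 2 * Real.pi * Real.exp (-u) := by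
  have hm : ∀ t : ℝ, mellin (fun x : ℝ => ((Real.exp (-x) : ℝ) : ℂ)) (σ + t * Complex.I)
      = Complex.Gamma (σ + t * Complex.I) := fun t => mellin_exp_neg (by simpa)
  have h := mellinInv_mellin_eq σ (fun x : ℝ => ((Real.exp (-x) : ℝ) : ℂ)) hu
    (mellinConvergent_exp_neg (by simpa))
    (by
      simp only [Complex.VerticalIntegrable, hm]
      exact integrable_Gamma_vertical hσ0 hσ1)
    (by fun_prop)
  simp only [mellinInv, hm, smul_eq_mul] at h
  simp_rw [mul_comm (Complex.Gamma _)]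
  rw [← h, Complex.real_smul]
  have : (Real.pi : ℂ) ≠ 0 := by exact_mod_cast Real.pi_ne_zero
  push_cast
  rw [← mul_assoc, mul_one_div_cancel (mul_ne_zero two_ne_zero this), one_mul]

theorem mellinConvergent_exp_neg_sqrt_mul {x : ℝ} (hx : 0 < x) {w : ℂ} (hw : 0 < w.re) :
    MellinConvergent (fun y : ℝ => ((Real.exp (-√(x * y)) : ℝ) : ℂ)) w := by
  rw [MellinConvergent.comp_mul_left (f := fun y : ℝ => ((Real.exp (-√y) : ℝ) : ℂ)) hx]
  simp_rw [Real.sqrt_eq_rpow]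
  rw [MellinConvergent.comp_rpow (f := fun y : ℝ => ((Real.exp (-y) : ℝ) : ℂ)) (by norm_num)]
  refine mellinConvergent_exp_neg ?_
  rw [Complex.div_ofReal_re]
  positivity

theorem mellin_exp_neg_sqrt_mul {x : ℝ} (hx : 0 < x) {w : ℂ} (hw : 0 < w.re) :
    mellin (fun y : ℝ => ((Real.exp (-√(x * y)) : ℝ) : ℂ)) w
      = 2 * (x : ℂ) ^ (-w) * Complex.Gamma (2 * w) := by
  rw [mellin_comp_mul_left (fun y : ℝ => ((Real.exp (-√y) : ℝ) : ℂ)) w hx]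
  simp_rw [Real.sqrt_eq_rpow]
  have h2 : w / ((1 / 2 : ℝ) : ℂ) = 2 * w := by push_cast; ring
  rw [mellin_comp_rpow (fun y : ℝ => ((Real.exp (-y) : ℝ) : ℂ)) w (1 / 2), h2,
    mellin_exp_neg (by simpa using hw), Complex.real_smul, smul_eq_mul]
  norm_num
  ring

theorem integrable_exp_neg_mul_cosh {Y : ℝ} (hY : 0 < Y) :
    Integrable fun u : ℝ => Real.exp (-Y * Real.cosh u) := by
  refine (integrable_exp_neg_mul_sq (half_pos hY)).mono' (by fun_prop) (ae_of_all _ fun u => ?_)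
  rw [Real.norm_of_nonneg (Real.exp_pos _).le]
  refine Real.exp_le_exp.2 ?_
  have : u ^ 2 / 2 ≤ Real.cosh u := by
    have h := Real.cosh_sq (u / 2)
    have h2 := Real.cosh_two_mul (u / 2)
    rw [mul_div_cancel₀ u two_ne_zero] at h2
    have h3 : (u / 2) ^ 2 ≤ Real.sinh (u / 2) ^ 2 := by
      rw [sq_le_sq, Real.abs_sinh]
      exact Real.self_le_sinh_iff.2 (abs_nonneg _)
    nlinarith
  nlinarith

theorem integral_exp_mul_exp_neg_cosh {Y : ℝ} (hY : 0 < Y) (τ : ℝ) :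
    ∫ u : ℝ, Complex.exp (-(2 * Complex.I * τ * u)) * (Real.exp (-Y * Real.cosh u) : ℝ)
      = 2 * (besselKi (2 * τ) Y : ℝ) := by
  have hi := integrable_exp_neg_mul_cosh hY
  have hI : ∀ c : ℂ, c.re = 0 → Integrable fun u : ℝ =>
      Complex.exp (c * u) * (Real.exp (-Y * Real.cosh u) : ℝ) := fun c hc =>
    hi.ofReal.bdd_mul (c := 1) (by fun_prop) (ae_of_all _ fun u => by simp [Complex.norm_exp, hc])
  set J := ∫ u : ℝ, Complex.exp (-(2 * Complex.I * τ * u)) * (Real.exp (-Y * Real.cosh u) : ℝ)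
    with hJ
  have hneg : J = ∫ u : ℝ, Complex.exp (2 * Complex.I * τ * u)
      * (Real.exp (-Y * Real.cosh u) : ℝ) := by
    rw [hJ, ← integral_neg_eq_self]
    simp
  have hsum : J + J = 2 * ((∫ u : ℝ, Real.exp (-Y * Real.cosh u) * Real.cos (2 * τ * u) : ℝ) : ℂ) := by
    nth_rw 2 [hneg]
    rw [hJ, ← integral_add (by simpa only [neg_mul] using hI (-(2 * Complex.I * τ)) (by simp))
      (hI _ (by simp)), ← integral_complex_ofReal, ← integral_const_mul]
    congr 1
    ext u
    push_cast
    rw [Complex.cos, show (2 * (τ : ℂ) * u) * Complex.I = 2 * Complex.I * τ * u by ring,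
      show -(2 * (τ : ℂ) * u) * Complex.I = -(2 * Complex.I * τ * u) by ring]
    ring
  have habs : (∫ u : ℝ, Real.exp (-Y * Real.cosh u) * Real.cos (2 * τ * u))
      = 2 * besselKi (2 * τ) Y := by
    rw [besselKi, ← integral_comp_abs
      (f := fun u => Real.exp (-Y * Real.cosh u) * Real.cos (2 * τ * u))]
    congr 1
    ext u
    rw [Real.cosh_abs]
    congr 1
    rcases abs_choice u with h | h <;> rw [h]
    rw [mul_neg, Real.cos_neg]
  rw [habs] at hsum
  push_cast at hsum
  linear_combination hsum / 2

theorem mellin_exp_neg_add_inv {Y : ℝ} (hY : 0 < Y) (τ : ℝ) :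
    mellin (fun r : ℝ => ((Real.exp (-Y * ((r + r⁻¹) / 2)) : ℝ) : ℂ)) (2 * Complex.I * τ)
      = 2 * (besselKi (2 * τ) Y : ℝ) := by
  rw [mellin_eq_fourier, Real.fourier_real_eq_integral_exp_smul, ← integral_exp_mul_exp_neg_cosh hY]
  congr 1
  ext u
  have hpi : (Real.pi : ℂ) ≠ 0 := by exact_mod_cast Real.pi_ne_zero
  rw [← Real.exp_neg, neg_neg, add_comm (Real.exp (-u)), ← Real.cosh_eq]
  simp
  congr 1
  field_simp

theorem integral_Gamma_mul_Gamma_mul_cpow {a x : ℝ} (ha0 : 0 < a) (ha1 : a ≤ 1 / 2) (hx : 0 < x)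
    (τ : ℝ) :
    ∫ t : ℝ, Complex.Gamma (a + t * Complex.I + Complex.I * τ)
        * Complex.Gamma (a + t * Complex.I - Complex.I * τ) * (x : ℂ) ^ (a + t * Complex.I)
      = 4 * Real.pi * (besselKi (2 * τ) (2 / √x) : ℝ) := by
  have hsx : 0 < √x := Real.sqrt_pos.2 hx
  have hxC : (x : ℂ) ≠ 0 := by exact_mod_cast hx.ne'
  let F : ℝ → ℝ → ℂ := fun t v => ((Real.exp (-v) : ℂ)
    * (v : ℂ) ^ ((a + t * Complex.I + Complex.I * τ) - 1))
    * (Complex.Gamma (a + t * Complex.I - Complex.I * τ) * (x : ℂ) ^ (a + t * Complex.I))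
  have hL : ∀ t : ℝ, Complex.Gamma (a + t * Complex.I + Complex.I * τ)
        * Complex.Gamma (a + t * Complex.I - Complex.I * τ) * (x : ℂ) ^ (a + t * Complex.I)
      = ∫ v in Ioi (0 : ℝ), F t v := by
    intro t
    simp only [F]
    rw [integral_mul_const, mul_assoc, Complex.Gamma_eq_integral (by simpa),
      Complex.GammaIntegral]
  have hGi : Integrable fun t : ℝ => Complex.Gamma (a + t * Complex.I - Complex.I * τ) := by
    have := (integrable_Gamma_vertical ha0 ha1).comp_sub_right τ
    refine this.congr (ae_of_all _ fun t => ?_)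
    simp only
    congr 1
    push_cast; ring
  have hF : Integrable (Function.uncurry F) (volume.prod (volume.restrict (Ioi (0 : ℝ)))) := by
    have hv : Integrable (fun v : ℝ => Real.exp (-v) * v ^ (a - 1))
        (volume.restrict (Ioi (0 : ℝ))) := Real.GammaIntegral_convergent ha0
    have hprod := (hGi.norm.mul_const (x ^ a)).mul_prod hv
    refine hprod.mono' ?_ ?_
    · have hm : Measurable fun t : ℝ => Complex.Gamma (a + t * Complex.I - Complex.I * τ) :=
        (continuous_Gamma_vertical (by fun_prop) (by simpa)).measurable
      refine Measurable.aestronglyMeasurable ?_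
      exact Measurable.mul (by fun_prop) ((hm.comp measurable_fst).mul (by fun_prop))
    · have hae : ∀ᵐ p : ℝ × ℝ ∂(volume.prod (volume.restrict (Ioi (0 : ℝ)))), p.2 ∈ Ioi (0:ℝ) :=
        Measure.quasiMeasurePreserving_snd.ae (ae_restrict_mem measurableSet_Ioi)
      filter_upwards [hae] with p hp
      refine le_of_eq ?_
      simp only [F, Function.uncurry_def, norm_mul, Complex.norm_real, Real.norm_eq_abs,
        abs_of_pos (Real.exp_pos _), Complex.norm_cpow_eq_rpow_re_of_pos hx,
        Complex.norm_cpow_eq_rpow_re_of_pos hp]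
      simp
      ring
  have hinner : ∀ v ∈ Ioi (0 : ℝ), ∫ t : ℝ, F t v = (2 * Real.pi * (x : ℂ) ^ (Complex.I * τ))
      * ((v : ℂ) ^ ((2 * Complex.I * τ) - 1) • ((Real.exp (-v - (x * v)⁻¹) : ℝ) : ℂ)) := by
    intro v hv
    have hv0 : (v : ℂ) ≠ 0 := by exact_mod_cast (ne_of_gt hv)
    have hxv : 0 < x * v := mul_pos hx hv
    have h := integral_Gamma_mul_cpow_neg ha0 ha1 (inv_pos.2 hxv)
    rw [← integral_sub_right_eq_self _ τ] at h
    have hpt : ∀ t : ℝ, F t v = (Real.exp (-v) * (v : ℂ) ^ ((2 * Complex.I * τ) - 1)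
        * (x : ℂ) ^ (Complex.I * τ)) * (Complex.Gamma (a + (t - τ : ℝ) * Complex.I)
          * (((x * v)⁻¹ : ℝ) : ℂ) ^ (-(a + (t - τ : ℝ) * Complex.I))) := by
      intro t
      have e : (a : ℂ) + t * Complex.I - Complex.I * τ = a + (t - τ : ℝ) * Complex.I := by
        push_cast; ring
      have e1 : (a + t * Complex.I + Complex.I * τ) - 1
          = ((2 * Complex.I * τ) - 1) + (a + (t - τ : ℝ) * Complex.I) := by
        push_cast; ring
      have e2 : (a : ℂ) + t * Complex.I = Complex.I * τ + (a + (t - τ : ℝ) * Complex.I) := by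
        push_cast; ring
      have e3 : (((x * v)⁻¹ : ℝ) : ℂ) ^ (-(a + (t - τ : ℝ) * Complex.I))
          = (x : ℂ) ^ (a + (t - τ : ℝ) * Complex.I) * (v : ℂ) ^ (a + (t - τ : ℝ) * Complex.I) := by
        rw [Complex.cpow_neg, Complex.ofReal_inv, Complex.inv_cpow _ _ (by
          rw [Complex.arg_ofReal_of_nonneg hxv.le]; exact Real.pi_pos.ne), inv_inv,
          Complex.ofReal_mul, Complex.mul_cpow_ofReal_nonneg hx.le (le_of_lt hv)]
      simp only [F]
      rw [e, e1, e2, e3, Complex.cpow_add _ _ hv0, Complex.cpow_add _ _ hxC]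
      ring
    simp_rw [hpt]
    rw [integral_const_mul, h, show -v - (x * v)⁻¹ = -v + -(x * v)⁻¹ from sub_eq_add_neg _ _, Real.exp_add, smul_eq_mul]
    push_cast
    ring
  simp_rw [hL]
  rw [integral_integral_swap hF, setIntegral_congr_fun measurableSet_Ioi hinner,
    integral_const_mul]
  have hY : 0 < 2 / √x := by positivity
  have hmel := mellin_exp_neg_add_inv hY τ
  have hscale := mellin_comp_mul_left (fun r : ℝ =>
    ((Real.exp (-(2 / √x) * ((r + r⁻¹) / 2)) : ℝ) : ℂ)) (2 * Complex.I * τ) hsx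
  rw [hmel] at hscale
  have hfun : (fun v : ℝ => ((Real.exp (-(2 / √x) * ((√x * v + (√x * v)⁻¹) / 2)) : ℝ) : ℂ))
      = fun v : ℝ => ((Real.exp (-v - (x * v)⁻¹) : ℝ) : ℂ) := by
    ext v
    congr 2
    rw [mul_inv, mul_inv]
    have hsq : x⁻¹ = (√x)⁻¹ * (√x)⁻¹ := by rw [← mul_inv, Real.mul_self_sqrt hx.le]
    rw [hsq]
    field_simp
    ring
  rw [hfun, mellin] at hscale
  rw [hscale]
  have hcpow : (x : ℂ) ^ (Complex.I * τ) * ((√x : ℝ) : ℂ) ^ (-(2 * Complex.I * τ)) = 1 := by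
    have : (x : ℂ) ^ (Complex.I * τ) = ((√x : ℝ) : ℂ) ^ (2 * Complex.I * τ) := by
      conv_lhs => rw [← Real.mul_self_sqrt hx.le, Complex.ofReal_mul,
        Complex.mul_cpow_ofReal_nonneg hsx.le hsx.le,
        ← Complex.cpow_add _ _ (by exact_mod_cast hsx.ne')]
      congr 1
      ring
    rw [this, ← Complex.cpow_add _ _ (by exact_mod_cast hsx.ne'), add_neg_cancel,
      Complex.cpow_zero]
  rw [smul_eq_mul]
  linear_combination (4 * Real.pi * (besselKi (2 * τ) (2 / √x) : ℂ)) * hcpow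

theorem four_cpow_mul_Gamma_three_sub_two_mul (s : ℂ) :
    (4 : ℂ) ^ s * (2 * Complex.Gamma (3 - 2 * s)) * √Real.pi
      = 8 * (Complex.Gamma (2 - s) * Complex.Gamma (3 / 2 - s)) := by
  have h := Complex.Gamma_mul_Gamma_add_half (3 / 2 - s)
  have h4 : (4 : ℂ) ^ s = 2 ^ (2 * s) := by
    have := Complex.mul_cpow_ofReal_nonneg zero_le_two zero_le_two s
    push_cast at this
    rw [two_mul, Complex.cpow_add _ _ two_ne_zero, ← this]
    norm_num
  rw [show 3 / 2 - s + 1 / 2 = 2 - s by ring, show 2 * (3 / 2 - s) = 3 - 2 * s by ring,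
    show 1 - (3 - 2 * s) = 2 * s - 2 by ring, Complex.cpow_sub _ _ two_ne_zero, ← h4,
    Complex.cpow_ofNat] at h
  linear_combination -8 * h

theorem exp_neg_sqrt_mul_cpow_eq {x y : ℝ} (hy : 0 < y) (s : ℂ) :
    ((Real.exp (-√(x * y)) : ℝ) : ℂ) * ((y : ℂ) / 4) ^ (-s) * (√y : ℝ)
      = 4 ^ s * ((y : ℂ) ^ ((3 / 2 - s) - 1) • ((Real.exp (-√(x * y)) : ℝ) : ℂ)) := by
  have hy0 : (y : ℂ) ≠ 0 := by exact_mod_cast hy.ne'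
  have h4 : ((y : ℂ) / 4) ^ (-s) = (y : ℂ) ^ (-s) * 4 ^ s := by
    have h := Complex.mul_cpow_ofReal_nonneg hy.le (by norm_num : (0 : ℝ) ≤ 4⁻¹) (-s)
    have h' : (((4 : ℝ)⁻¹ : ℝ) : ℂ) ^ (-s) = 4 ^ s := by
      rw [Complex.cpow_neg, Complex.ofReal_inv, Complex.inv_cpow _ _ (by
        rw [Complex.arg_ofReal_of_nonneg (by norm_num)]; exact Real.pi_pos.ne), inv_inv]
      norm_num
    rw [h'] at h
    rw [← h]
    push_cast
    rfl
  have hsq : ((√y : ℝ) : ℂ) = (y : ℂ) ^ (1 / 2 : ℂ) := by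
    rw [Real.sqrt_eq_rpow, Complex.ofReal_cpow hy.le]
    norm_num
  rw [h4, hsq, show (3 / 2 - s) - 1 = -s + 1 / 2 by ring, Complex.cpow_add _ _ hy0, smul_eq_mul]
  ring

theorem integrableOn_exp_neg_sqrt_mul_cpow {x : ℝ} (hx : 0 < x) {s : ℂ} (hs : s.re < 3 / 2) :
    IntegrableOn (fun y : ℝ =>
      ((Real.exp (-√(x * y)) : ℝ) : ℂ) * ((y : ℂ) / 4) ^ (-s) * (√y : ℝ)) (Ioi 0) := by
  have h := mellinConvergent_exp_neg_sqrt_mul hx (w := 3 / 2 - s) (by simpa)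
  exact IntegrableOn.congr_fun (h.const_mul (4 ^ s))
    (fun y hy => (exp_neg_sqrt_mul_cpow_eq hy s).symm) measurableSet_Ioi

theorem integral_exp_neg_sqrt_mul_cpow {x : ℝ} (hx : 0 < x) {s : ℂ} (hs : s.re < 3 / 2) :
    ∫ y in Ioi (0 : ℝ), ((Real.exp (-√(x * y)) : ℝ) : ℂ) * ((y : ℂ) / 4) ^ (-s) * (√y : ℝ)
      = 8 / √Real.pi * (Complex.Gamma (2 - s) * Complex.Gamma (3 / 2 - s))
        * (x : ℂ) ^ (s - 3 / 2) := by
  have h := mellin_exp_neg_sqrt_mul hx (w := 3 / 2 - s) (by simpa)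
  rw [mellin] at h
  rw [setIntegral_congr_fun measurableSet_Ioi fun y hy => exp_neg_sqrt_mul_cpow_eq hy s,
    integral_const_mul, h, neg_sub, show 2 * (3 / 2 - s) = 3 - 2 * s by ring]
  have hpi : ((√Real.pi : ℝ) : ℂ) ≠ 0 := by
    exact_mod_cast (Real.sqrt_pos.2 Real.pi_pos).ne'
  have hd := four_cpow_mul_Gamma_three_sub_two_mul s
  rw [div_mul_eq_mul_div, ← hd, mul_div_cancel_right₀ _ hpi]
  ring

/-- The Laplace-type representation (2.16) of K_{2iτ}(2/√x). -/
theorem besselK_laplace_repr (x τ μ : ℝ) (hx : 0 < x) (hτ : 0 < τ)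
    (hμ1 : 1 < μ) (hμ2 : μ < 9/8) :
    (∀ y : ℝ, 0 < y → Integrable (fun t : ℝ =>
      Complex.Gamma (((μ:ℂ) + (t:ℂ)*Complex.I) - 1 + Complex.I*(τ:ℂ))
        * Complex.Gamma (((μ:ℂ) + (t:ℂ)*Complex.I) - 1 - Complex.I*(τ:ℂ))
        / (Complex.Gamma (2 - ((μ:ℂ) + (t:ℂ)*Complex.I)) * Complex.Gamma (3/2 - ((μ:ℂ) + (t:ℂ)*Complex.I)))
        * ((y:ℂ)/4) ^ (-((μ:ℂ) + (t:ℂ)*Complex.I)))) ∧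
    ((besselKi (2*τ) (2/Real.sqrt x) : ℝ) : ℂ) =
      ((Real.sqrt (Real.pi*x)/4 : ℝ) : ℂ) * ∫ y in Set.Ioi (0:ℝ),
        ((Real.exp (-Real.sqrt (x*y)) : ℝ) : ℂ) * hFn μ y τ * ((Real.sqrt y : ℝ) : ℂ) := by
  have hG := integrable_gammaQuotient hμ1 hμ2 τ
  refine ⟨fun y hy => ?_, ?_⟩
  · refine hG.mul_bdd (c := (y / 4) ^ (-μ)) (Continuous.aestronglyMeasurable ?_)
      (ae_of_all _ fun t => ?_)
    · refine Continuous.const_cpow (by fun_prop) (Or.inl ?_)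
      exact div_ne_zero (by exact_mod_cast hy.ne') (by norm_num)
    · have h := Complex.norm_cpow_eq_rpow_re_of_pos (show 0 < y / 4 by positivity)
        (-((μ:ℂ) + (t:ℂ)*Complex.I))
      push_cast at h
      rw [h]
      simp
  let F : ℝ → ℝ → ℂ := fun y t => gammaQuotient μ τ t * (((Real.exp (-√(x * y)) : ℝ) : ℂ)
    * ((y : ℂ) / 4) ^ (-((μ:ℂ) + (t:ℂ)*Complex.I)) * (√y : ℝ))
  have hre : ∀ t : ℝ, ((μ:ℂ) + (t:ℂ)*Complex.I).re < 3 / 2 := fun t => by simp; linarith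
  have hFi : Integrable (Function.uncurry F) ((volume.restrict (Ioi (0 : ℝ))).prod volume) := by
    have hy := integrableOn_exp_neg_sqrt_mul_cpow hx (s := μ) (by simp; linarith)
    refine (hy.norm.mul_prod hG.norm).mono' ?_ ?_
    · exact (hG.aestronglyMeasurable.comp_snd).mul
        (Measurable.aestronglyMeasurable (by fun_prop))
    · have hae : ∀ᵐ p : ℝ × ℝ ∂((volume.restrict (Ioi (0 : ℝ))).prod volume), p.1 ∈ Ioi (0:ℝ) :=
        Measure.quasiMeasurePreserving_fst.ae (ae_restrict_mem measurableSet_Ioi)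
      filter_upwards [hae] with p hp
      refine le_of_eq ?_
      have h : ∀ z : ℂ, ‖((p.1 : ℂ) / 4) ^ z‖ = (p.1 / 4) ^ z.re := fun z => by
        have h := Complex.norm_cpow_eq_rpow_re_of_pos (div_pos hp (by norm_num : (0 : ℝ) < 4)) z
        push_cast at h
        exact h
      simp only [F, Function.uncurry_def, norm_mul, h]
      simp
      ring
  have hcongr : ∀ y : ℝ, ((Real.exp (-√(x * y)) : ℝ) : ℂ) * hFn μ y τ * ((√y : ℝ) : ℂ)
      = (1 / (8 * (Real.pi : ℂ))) * ∫ t : ℝ, F y t := fun y => by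
    have h : ∀ t, F y t = ((Real.exp (-√(x * y)) : ℝ) : ℂ) * ((√y : ℝ) : ℂ)
        * (gammaQuotient μ τ t * ((y : ℂ) / 4) ^ (-((μ:ℂ) + (t:ℂ)*Complex.I))) := fun t => by
      simp only [F]; ring
    simp_rw [h, integral_const_mul, hFn, gammaQuotient]
    ring
  have hinner : ∀ t : ℝ, ∫ y in Ioi (0 : ℝ), F y t = (8 / √Real.pi * (√x : ℂ)⁻¹)
      * (Complex.Gamma ((μ - 1 : ℝ) + t * Complex.I + Complex.I * τ)
        * Complex.Gamma ((μ - 1 : ℝ) + t * Complex.I - Complex.I * τ)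
        * (x : ℂ) ^ ((μ - 1 : ℝ) + t * Complex.I)) := fun t => by
    have hxC : (x : ℂ) ≠ 0 := by exact_mod_cast hx.ne'
    have hsq : ((√x : ℝ) : ℂ) = (x : ℂ) ^ (1 / 2 : ℂ) := by
      rw [Real.sqrt_eq_rpow, Complex.ofReal_cpow hx.le]
      norm_num
    have h1 : Complex.Gamma (2 - ((μ:ℂ) + (t:ℂ)*Complex.I)) ≠ 0 :=
      Complex.Gamma_ne_zero_of_re_pos (by simp; linarith)
    have h2 : Complex.Gamma (3 / 2 - ((μ:ℂ) + (t:ℂ)*Complex.I)) ≠ 0 :=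
      Complex.Gamma_ne_zero_of_re_pos (by simp; linarith)
    simp only [F]
    rw [integral_const_mul, integral_exp_neg_sqrt_mul_cpow hx (hre t), hsq,
      show (μ:ℂ) + (t:ℂ)*Complex.I - 3 / 2 = -(1 / 2) + ((μ - 1 : ℝ) + t * Complex.I) by
        push_cast; ring, Complex.cpow_add _ _ hxC, Complex.cpow_neg, gammaQuotient,
      show (μ:ℂ) + (t:ℂ)*Complex.I - 1 = (μ - 1 : ℝ) + t * Complex.I by push_cast; ring]
    generalize Complex.Gamma (3 / 2 - ((μ:ℂ) + (t:ℂ)*Complex.I)) = g at h2 ⊢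
    field_simp
  simp_rw [hcongr]
  rw [integral_const_mul, integral_integral_swap hFi]
  simp_rw [hinner]
  rw [integral_const_mul, integral_Gamma_mul_Gamma_mul_cpow (by linarith) (by linarith) hx,
    Real.sqrt_mul Real.pi_pos.le]
  have hsx : ((√x : ℝ) : ℂ) ≠ 0 := by exact_mod_cast (Real.sqrt_pos.2 hx).ne'
  have hsp : ((√Real.pi : ℝ) : ℂ) ≠ 0 := by exact_mod_cast (Real.sqrt_pos.2 Real.pi_pos).ne'
  have hpi : (Real.pi : ℂ) ≠ 0 := by exact_mod_cast Real.pi_ne_zero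
  push_cast
  field_simp
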